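/- Let n ≥ 2 and m ≥ 1 be integers and let ζ_n = exp(2πi/n). Then 𝔷_n(ζ_n; m, 2) = (1/(n(m+1)))·( C(n−1, m) + (−1)^m · C(n−1, 2m+1) ), where C(a,b) denotes the binomial coefficient. -/

import Mathlib

/-- The primitive `n`-th root of unity `ζ_n = exp(2πi/n)`. -/
noncomputable def zetaN (n : ℕ) : ℂ := Complex.exp (2 * Real.pi * Complex.I / n)

/-- The finite `q`-multiple zeta value `𝔷_n(ζ_n; m, s)`. -/
noncomputable def zmzv (n m s : ℕ) : ℂ :=
  ∑ T ∈ (Finset.Icc 1 (n - 1)).powersetCard m,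
    (∏ i ∈ T, (1 - zetaN n ^ i) ^ s)⁻¹

open Polynomial Finset

/-- Coefficients of `∏ (1 + a i X)` are the elementary symmetric functions of the `a i`. -/
lemma coeff_prod_one_add_C_mul_X {ι R : Type*} [CommRing R] (s : Finset ι) (a : ι → R) (m : ℕ) :
    (∏ i ∈ s, (1 + C (a i) * X)).coeff m = ∑ t ∈ s.powersetCard m, ∏ i ∈ t, a i := by
  rw [prod_one_add, finsetSum_coeff, powersetCard_eq_filter, sum_filter]
  refine sum_congr rfl fun t _ => ?_
  rw [prod_mul_distrib, prod_const, ← map_prod, coeff_C_mul_X_pow]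
  simp only [eq_comm]

lemma coeff_one_add_C_mul_X_pow {R : Type*} [CommRing R] (a : R) (n k : ℕ) :
    ((1 + C a * X) ^ n).coeff k = n.choose k * a ^ k := by
  have h : (1 + C a * X) ^ n = ((1 + X : R[X]) ^ n).comp (C a * X) := by simp
  rw [h, comp_C_mul_X_coeff, coeff_one_add_X_pow]

namespace IsPrimitiveRoot

variable {K : Type*} [Field K] {ζ : K} {N : ℕ}

lemma one_sub_pow_ne_zero (hζ : IsPrimitiveRoot ζ (N + 1)) {i : ℕ} (hi : i ∈ Icc 1 N) :
    1 - ζ ^ i ≠ 0 := by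
  rw [mem_Icc] at hi
  exact sub_ne_zero.2 (hζ.pow_ne_one_of_pos_of_lt (by lia) (by lia)).symm

/-- The generating polynomial of the elementary symmetric functions of the `1 / (1 - ζ ^ i)`. -/
lemma mul_prod_one_add_inv_one_sub_pow (hζ : IsPrimitiveRoot ζ (N + 1)) :
    C ((N : K) + 1) * X * ∏ i ∈ Icc 1 N, (1 + C (1 - ζ ^ i)⁻¹ * X) = (1 + X) ^ (N + 1) - 1 := by
  have hroots : (X : K[X]) ^ (N + 1) - 1 = (∏ i ∈ Icc 1 N, (X - C (ζ ^ i))) * (X - 1) := by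
    have h := X_pow_sub_C_eq_prod hζ N.succ_pos (one_pow (N + 1))
    rw [C_1, prod_range_succ'] at h
    rw [h, range_eq_Ico, prod_Ico_add' (fun i => X - C (ζ ^ i * 1)) 0 N 1]
    simp [Finset.Ico_add_one_right_eq_Icc]
  have horder : ∏ i ∈ Icc 1 N, (1 - ζ ^ i) = (N : K) + 1 := by
    rw [← hζ.prod_one_sub_pow_eq_order, range_eq_Ico, prod_Ico_add' (fun i => 1 - ζ ^ i) 0 N 1]
    simp [Finset.Ico_add_one_right_eq_Icc]
  have hfactor : ∏ i ∈ Icc 1 N, (1 + X - C (ζ ^ i)) =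
      C ((N : K) + 1) * ∏ i ∈ Icc 1 N, (1 + C (1 - ζ ^ i)⁻¹ * X) := by
    rw [← horder, map_prod, ← prod_mul_distrib]
    refine prod_congr rfl fun i hi => ?_
    rw [mul_add, ← mul_assoc, ← C_mul, mul_inv_cancel₀ (hζ.one_sub_pow_ne_zero hi)]
    simp only [map_sub, map_one]
    ring
  have h := congrArg (fun p : K[X] => p.comp (1 + X)) hroots
  simp only [sub_comp, pow_comp, X_comp, one_comp, mul_comp, Polynomial.prod_comp, C_comp] at h
  rw [h, hfactor]
  ring

/-- The generating polynomial of the elementary symmetric functions of the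
`1 / (1 - ζ ^ i) ^ 2`, up to sign. -/
lemma sq_mul_expand_prod_one_add_inv_sq (hζ : IsPrimitiveRoot ζ (N + 1)) :
    C (((N : K) + 1) ^ 2) * (X ^ 2 *
        expand K 2 (∏ i ∈ Icc 1 N, (1 + C (-((1 - ζ ^ i) ^ 2)⁻¹) * X))) =
      (1 + C 1 * X) ^ (N + 1) + (1 + C (-1) * X) ^ (N + 1) - 1
        - expand K 2 ((1 + C (-1) * X) ^ (N + 1)) := by
  have h := hζ.mul_prod_one_add_inv_one_sub_pow
  have hneg := congrArg (fun p : K[X] => p.comp (-X)) h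
  simp only [sub_comp, add_comp, pow_comp, X_comp, one_comp, mul_comp, Polynomial.prod_comp, C_comp] at hneg
  have hsplit : expand K 2 (∏ i ∈ Icc 1 N, (1 + C (-((1 - ζ ^ i) ^ 2)⁻¹) * X)) =
      (∏ i ∈ Icc 1 N, (1 + C (1 - ζ ^ i)⁻¹ * X)) *
        ∏ i ∈ Icc 1 N, (1 + C (1 - ζ ^ i)⁻¹ * -X) := by
    rw [map_prod, ← prod_mul_distrib]
    refine prod_congr rfl fun i _ => ?_
    rw [← inv_pow]
    simp only [map_add, map_one, map_mul, expand_X, map_neg, map_pow, expand_C]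
    ring
  have hpow : expand K 2 ((1 + C (-1) * X) ^ (N + 1)) =
      (1 + X) ^ (N + 1) * (1 + -X) ^ (N + 1) := by
    rw [← mul_pow]
    simp only [map_add, map_one, map_mul, map_pow, expand_X, map_neg]
    ring
  rw [hsplit, hpow, C_pow]
  simp only [map_one, C_neg, one_mul, neg_mul]
  linear_combination (-C ((N : K) + 1) * -X * ∏ i ∈ Icc 1 N, (1 + C (1 - ζ ^ i)⁻¹ * -X)) * h
    - ((1 + X) ^ (N + 1) - 1) * hneg

/-- The elementary symmetric functions of the `1 / (1 - ζ ^ i) ^ 2`. -/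
lemma sq_mul_sum_powersetCard_inv_sq (hζ : IsPrimitiveRoot ζ (N + 1)) (m : ℕ) :
    ((N : K) + 1) ^ 2 * ∑ T ∈ (Icc 1 N).powersetCard m, (∏ i ∈ T, (1 - ζ ^ i) ^ 2)⁻¹ =
      (N + 1).choose (m + 1) + 2 * (-1) ^ m * (N + 1).choose (2 * (m + 1)) := by
  have h := congrArg (fun p : K[X] => p.coeff (2 * (m + 1))) hζ.sq_mul_expand_prod_one_add_inv_sq
  have hsign : ∑ T ∈ (Icc 1 N).powersetCard m, ∏ i ∈ T, -((1 - ζ ^ i) ^ 2)⁻¹ =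
      (-1) ^ m * ∑ T ∈ (Icc 1 N).powersetCard m, (∏ i ∈ T, (1 - ζ ^ i) ^ 2)⁻¹ := by
    rw [mul_sum]
    refine sum_congr rfl fun T hT => ?_
    rw [prod_neg, prod_inv_distrib, (mem_powersetCard.1 hT).2]
  have hone : (1 : K[X]).coeff (2 * (m + 1)) = 0 := by simp [coeff_one]
  simp only [coeff_sub, coeff_add, coeff_C_mul, coeff_one_add_C_mul_X_pow, hone,
    coeff_expand_mul' two_pos, one_pow, pow_mul, neg_one_sq] at h
  rw [mul_add_one 2 m, coeff_X_pow_mul, coeff_expand_mul' two_pos, coeff_prod_one_add_C_mul_X,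
    hsign] at h
  have hsq : ((-1 : K) ^ m) ^ 2 = 1 := by rw [← pow_mul, mul_comm, pow_mul, neg_one_sq, one_pow]
  rw [mul_add_one 2 m]
  linear_combination (-1) ^ m * h + ((N + 1).choose (m + 1) - ((N : K) + 1) ^ 2 *
    ∑ T ∈ (Icc 1 N).powersetCard m, (∏ i ∈ T, (1 - ζ ^ i) ^ 2)⁻¹) * hsq

end IsPrimitiveRoot

theorem stmt9 (n m : ℕ) (hn : 2 ≤ n) (hm : 1 ≤ m) :
    zmzv n m 2 = (1 / ((n : ℂ) * ((m : ℂ) + 1))) *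
      (((n - 1).choose m : ℂ) + (-1 : ℂ) ^ m * ((n - 1).choose (2 * m + 1) : ℂ)) := by
  obtain ⟨N, rfl⟩ : ∃ N, n = N + 1 := ⟨n - 1, by lia⟩
  have hζ : IsPrimitiveRoot (zetaN (N + 1)) (N + 1) :=
    Complex.isPrimitiveRoot_exp (N + 1) N.succ_ne_zero
  have h := hζ.sq_mul_sum_powersetCard_inv_sq m
  have hN : (N : ℂ) + 1 ≠ 0 := N.cast_add_one_ne_zero
  have hm' : (m : ℂ) + 1 ≠ 0 := m.cast_add_one_ne_zero
  have h₁ : ((N : ℂ) + 1) * N.choose m = (N + 1).choose (m + 1) * (m + 1) := by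
    exact_mod_cast N.add_one_mul_choose_eq m
  have h₂ : ((N : ℂ) + 1) * N.choose (2 * m + 1) =
      (N + 1).choose (2 * (m + 1)) * (2 * (m + 1)) := by
    exact_mod_cast N.add_one_mul_choose_eq (2 * m + 1)
  simp only [zmzv, Nat.add_sub_cancel, Nat.cast_add, Nat.cast_one]
  rw [one_div, inv_mul_eq_div, eq_div_iff (mul_ne_zero hN hm')]
  apply mul_left_cancel₀ hN
  linear_combination ((m : ℂ) + 1) * h - h₁ - (-1) ^ m * h₂
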